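/- Suppose a CAT trajectory satisfies Assumption 1 with constants L, Δ_f ∈ (0,∞). Then for all i ∈ ℕ such that π(i) < ∞, we have τ(i) < ∞ and τ(i) − π(i) ≤ log_{γ₂ω₂}(ω₂^{3i}·max{d_min(π(i))/r₁, 1}), where d_min(k) := γ₂ω₁⁻¹C^{−1/2}L^{−1/2}ε_k^{1/2}. -/

import Mathlib

open scoped RealInnerProductSpace
open Filter

noncomputable section

/-- Application of the Hessian-based quadratic model's gradient:
`∇M_x(d) = ∇²f(x) d + ∇f(x)`. -/
def gradModel {n : ℕ} (f : EuclideanSpace ℝ (Fin n) → ℝ)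
    (x d : EuclideanSpace ℝ (Fin n)) : EuclideanSpace ℝ (Fin n) :=
  fderiv ℝ (gradient f) x d + gradient f x

/-- The quadratic model `M_x(d) = (1/2) dᵀ ∇²f(x) d + ∇f(x)ᵀ d`. -/
def modelVal {n : ℕ} (f : EuclideanSpace ℝ (Fin n) → ℝ)
    (x d : EuclideanSpace ℝ (Fin n)) : ℝ :=
  (1/2) * ⟪fderiv ℝ (gradient f) x d, d⟫ + ⟪gradient f x, d⟫

/-- The ratio `ρ̂` of actual to (modified) predicted reduction; equals `0` when the
denominator is `0` (division by zero convention). -/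
def rhoHat {n : ℕ} (θ : ℝ) (f : EuclideanSpace ℝ (Fin n) → ℝ)
    (x d : EuclideanSpace ℝ (Fin n)) : ℝ :=
  (f x - f (x + d)) /
    (-(modelVal f x d) + (θ/2) * min ‖gradient f x‖ ‖gradient f (x + d)‖ * ‖d‖)

/-- A CAT trajectory (Algorithm 1, with `σ = 0`): sequences of iterates `x`, directions `d`,
radii `r`, multipliers `δ`, gradient-norm estimates `ε` and thresholds `b` (in `(0,∞]`,
modeled as `EReal`), indexed from `k = 1`. -/
structure CATTraj {n : ℕ} (θ β ω₁ ω₂ γ₁ γ₂ γ₃ ξ : ℝ)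
    (f : EuclideanSpace ℝ (Fin n) → ℝ)
    (x d : ℕ → EuclideanSpace ℝ (Fin n))
    (r δ ε : ℕ → ℝ) (b : ℕ → EReal) : Prop where
  hf : ∀ y, DifferentiableAt ℝ f y
  hf' : ∀ y, DifferentiableAt ℝ (gradient f) y
  r_pos : ∀ k, 1 ≤ k → 0 < r k
  δ_nonneg : ∀ k, 1 ≤ k → 0 ≤ δ k
  ε_pos : ∀ k, 1 ≤ k → 0 < ε k
  b_pos : ∀ k, 1 ≤ k → 0 < b k
  sub_grad : ∀ k, 1 ≤ k → ‖gradModel f (x k) (d k) + δ k • d k‖ ≤ γ₁ * ε k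
  sub_comp : ∀ k, 1 ≤ k → γ₂ * δ k * r k ≤ δ k * ‖d k‖
  sub_rad : ∀ k, 1 ≤ k → ‖d k‖ ≤ r k
  sub_decr : ∀ k, 1 ≤ k → modelVal f (x k) (d k) ≤ -(γ₃ * (δ k / 2) * ‖d k‖ ^ 2)
  step_acc : ∀ k, 1 ≤ k → f (x k + d k) ≤ f (x k) → x (k+1) = x k + d k
  step_rej : ∀ k, 1 ≤ k → ¬ f (x k + d k) ≤ f (x k) → x (k+1) = x k
  radius_succ : ∀ k, 1 ≤ k → β ≤ rhoHat θ f (x k) (d k) →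
    r (k+1) = max (ω₂ * ‖d k‖) (r k)
  radius_fail : ∀ k, 1 ≤ k → ¬ β ≤ rhoHat θ f (x k) (d k) → r (k+1) = r k / ω₁
  eps_one : ε 1 = ‖gradient f (x 1)‖
  eps_succ_dec : ∀ k, 1 ≤ k → (f (x k + d k) : EReal) ≤ (f (x k) : EReal) + b k →
    ε (k+1) = min (ε k) ‖gradient f (x k + d k)‖
  eps_succ_keep : ∀ k, 1 ≤ k → ¬ ((f (x k + d k) : EReal) ≤ (f (x k) : EReal) + b k) →
    ε (k+1) = ε k
  b_lb : ∀ k, 1 ≤ k → ((ξ * ε k * ‖d k‖ : ℝ) : EReal) ≤ b k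

/-- Assumption 1: bounded optimality gap along the trajectory, and the two
Lipschitz-Hessian-type inequalities along the steps. -/
def Assumption1 {n : ℕ} (L Δf : ℝ) (f : EuclideanSpace ℝ (Fin n) → ℝ)
    (x d : ℕ → EuclideanSpace ℝ (Fin n)) : Prop :=
  ∀ k, 1 ≤ k →
    f (x 1) - f (x k) ≤ Δf ∧
    ‖gradient f (x k + d k)‖ ≤ ‖gradModel f (x k) (d k)‖ + (L/2) * ‖d k‖ ^ 2 ∧
    f (x k + d k) ≤ f (x k) + modelVal f (x k) (d k) + (L/6) * ‖d k‖ ^ 3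

/-- `c₁ := (2 + 3γ₃(1−β))/(6(γ₃(1−β) − βθ))`. -/
def c1Def (θ β γ₃ : ℝ) : ℝ := (2 + 3 * γ₃ * (1 - β)) / (6 * (γ₃ * (1 - β) - β * θ))

/-- `c₂ := γ₃(1−β)/(γ₃(1−β) − βθ)`. -/
def c2Def (θ β γ₃ : ℝ) : ℝ := γ₃ * (1 - β) / (γ₃ * (1 - β) - β * θ)

/-- `C := max{1/(3ξ), 2c₁/(1 − 2γ₁c₂)}`. -/
def CDef (θ β γ₃ γ₁ ξ : ℝ) : ℝ :=
  max (1 / (3 * ξ)) (2 * c1Def θ β γ₃ / (1 - 2 * γ₁ * c2Def θ β γ₃))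

/-- `d_min` as a function of the value `e = ε_k`:
`γ₂ ω₁⁻¹ C^{-1/2} L^{-1/2} e^{1/2}`. -/
def dminDef (γ₂ ω₁ C L e : ℝ) : ℝ :=
  γ₂ * ω₁⁻¹ * (Real.sqrt C)⁻¹ * (Real.sqrt L)⁻¹ * Real.sqrt e

/-- `d_max` as a function of the value `e = ε_k`: `(2ω₂/(βθ)) Δf / e`. -/
def dmaxDef (ω₂ β θ Δf e : ℝ) : ℝ := (2 * ω₂ / (β * θ)) * (Δf / e)

/-- One step of the `π` recursion: the least index `m ≥ 1` with `ε_m < ε_p / 2`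
(`⊤` if there is none or if the previous index was `⊤`). -/
def nextPi (ε : ℕ → ℝ) (p : ℕ∞) : ℕ∞ :=
  if p = ⊤ then ⊤
  else sInf ((fun m : ℕ => (m : ℕ∞)) '' {m : ℕ | 1 ≤ m ∧ ε m < ε p.toNat / 2})

/-- `π(1) = 1` and, for `i > 1`, `π(i)` is the least `j` with `ε_j < ε_{π(i−1)}/2`
(`⊤` if none exists). -/
def piIdx (ε : ℕ → ℝ) : ℕ → ℕ∞
  | 0 => 1
  | 1 => 1
  | (i+2) => nextPi ε (piIdx ε (i+1))

/-- `τ(i) := min({j ≥ π(i) : ‖d_j‖ ≥ d_min(π(i))} ∪ {π(i+1)})`. -/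
def tauIdx {n : ℕ} (γ₂ ω₁ C L : ℝ)
    (d : ℕ → EuclideanSpace ℝ (Fin n)) (ε : ℕ → ℝ) (i : ℕ) : ℕ∞ :=
  if piIdx ε i = ⊤ then ⊤
  else
    min
      (sInf ((fun m : ℕ => (m : ℕ∞)) ''
        {j : ℕ | (piIdx ε i).toNat ≤ j ∧
          dminDef γ₂ ω₁ C L (ε (piIdx ε i).toNat) ≤ ‖d j‖}))
      (piIdx ε (i+1))

/-- The arithmetic core of the gradient decrease estimate: `a` stands for `γ₃(1-β)`, `q` for `βθ`,
`t` for `δ‖d‖` and `s` for `‖d‖²`. -/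
lemma gradient_lt_half {a q γ₁ C L g t s ε e : ℝ} (hγ : 0 ≤ γ₁) (ha : 0 < a)
    (hK : 0 < a - q - 2 * γ₁ * a)
    (hC : 2 / 3 + a ≤ C * (a - q - 2 * γ₁ * a)) (hL : 0 < L) (hs : 0 ≤ s)
    (hg : g ≤ γ₁ * ε + t + L / 2 * s) (ht : a * t ≤ q * g + L / 3 * s)
    (hε : ε ≤ e) (hsmall : C * L * s < e) : g < e / 2 := by
  have hγa : 0 ≤ γ₁ * a := mul_nonneg hγ ha.le
  have h1 : a * g ≤ a * (γ₁ * ε + t + L / 2 * s) := mul_le_mul_of_nonneg_left hg ha.le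
  have h2 : γ₁ * a * ε ≤ γ₁ * a * e := mul_le_mul_of_nonneg_left hε hγa
  have h3 : (2 / 3 + a) * (L * s) ≤ C * (a - q - 2 * γ₁ * a) * (L * s) :=
    mul_le_mul_of_nonneg_right hC (mul_nonneg hL.le hs)
  have h4 : (a - q - 2 * γ₁ * a) * (C * L * s) < (a - q - 2 * γ₁ * a) * e :=
    mul_lt_mul_of_pos_left hsmall hK
  have h5 : (a - q) * g < (a - q) * (e / 2) := by linarith
  exact lt_of_mul_lt_mul_left h5 (by linarith)

lemma CDef_pos {θ β γ₃ γ₁ ξ : ℝ} (hξ : 0 < ξ) : 0 < CDef θ β γ₃ γ₁ ξ :=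
  lt_of_lt_of_le (by positivity) (le_max_left _ _)

lemma parameter_gap_pos {θ β γ₁ γ₃ : ℝ} (hβ : β < 1) (hγ₃ : 0 < γ₃)
    (hγ₁ : γ₁ < (1/2) * (1 - β * θ / (γ₃ * (1 - β)))) :
    0 < γ₃ * (1 - β) - β * θ - 2 * γ₁ * (γ₃ * (1 - β)) := by
  have ha : 0 < γ₃ * (1 - β) := mul_pos hγ₃ (by linarith)
  have h := mul_lt_mul_of_pos_right hγ₁ ha
  have h2 : β * θ / (γ₃ * (1 - β)) * (γ₃ * (1 - β)) = β * θ := div_mul_cancel₀ _ ha.ne'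
  linarith

lemma CDef_mul_gap {θ β γ₁ γ₃ ξ : ℝ} (hβ : β < 1) (hγ₃ : 0 < γ₃) (hγ₁0 : 0 ≤ γ₁)
    (hγ₁ : γ₁ < (1/2) * (1 - β * θ / (γ₃ * (1 - β)))) :
    2 / 3 + γ₃ * (1 - β) ≤
      CDef θ β γ₃ γ₁ ξ * (γ₃ * (1 - β) - β * θ - 2 * γ₁ * (γ₃ * (1 - β))) := by
  have ha : 0 < γ₃ * (1 - β) := mul_pos hγ₃ (by linarith)
  have hgap := parameter_gap_pos hβ hγ₃ hγ₁
  have hK : 0 < γ₃ * (1 - β) - β * θ := by nlinarith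
  have h := mul_le_mul_of_nonneg_right (le_max_right (1 / (3 * ξ))
    (2 * c1Def θ β γ₃ / (1 - 2 * γ₁ * c2Def θ β γ₃))) hgap.le
  refine le_trans (le_of_eq ?_) h
  have h1 : 1 - 2 * γ₁ * c2Def θ β γ₃ =
      (γ₃ * (1 - β) - β * θ - 2 * γ₁ * (γ₃ * (1 - β))) / (γ₃ * (1 - β) - β * θ) := by
    unfold c2Def
    rw [eq_div_iff hK.ne', sub_mul, mul_assoc, div_mul_cancel₀ _ hK.ne']
    ring
  have h2 : 2 * c1Def θ β γ₃ = (2 / 3 + γ₃ * (1 - β)) / (γ₃ * (1 - β) - β * θ) := by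
    unfold c1Def
    rw [eq_div_iff hK.ne', mul_assoc, div_mul_eq_mul_div, mul_div_assoc,
      div_mul_cancel_right₀ hK.ne']
    ring
  rw [h1, h2, div_div_div_cancel_right₀ hK.ne', div_mul_cancel₀ _ hgap.ne']

lemma dminDef_pos {γ₂ ω₁ C L e : ℝ} (hγ₂ : 0 < γ₂) (hω₁ : 0 < ω₁) (hC : 0 < C) (hL : 0 < L)
    (he : 0 < e) : 0 < dminDef γ₂ ω₁ C L e := by
  have := Real.sqrt_pos.2 hC
  have := Real.sqrt_pos.2 hL
  have := Real.sqrt_pos.2 he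
  unfold dminDef
  positivity

lemma dminDef_mono {γ₂ ω₁ C L e e' : ℝ} (hγ₂ : 0 < γ₂) (hω₁ : 0 < ω₁) (h : e ≤ e') :
    dminDef γ₂ ω₁ C L e ≤ dminDef γ₂ ω₁ C L e' :=
  mul_le_mul_of_nonneg_left (Real.sqrt_le_sqrt h) (by positivity)

lemma mul_sq_lt_of_lt_dminDef {γ₂ ω₁ C L e y : ℝ} (hγ₂ : 0 < γ₂) (hγ₂1 : γ₂ ≤ 1) (hω₁ : 1 < ω₁)
    (hC : 0 < C) (hL : 0 < L) (he : 0 < e) (hy0 : 0 ≤ y) (hy : y < dminDef γ₂ ω₁ C L e) :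
    C * L * y ^ 2 < e := by
  have hsC := Real.sqrt_pos.2 hC
  have hsL := Real.sqrt_pos.2 hL
  have hCL : 0 < C * L := mul_pos hC hL
  have hD : dminDef γ₂ ω₁ C L e ^ 2 * (C * L) = (γ₂ * ω₁⁻¹) ^ 2 * e := by
    unfold dminDef
    simp only [mul_pow, inv_pow, Real.sq_sqrt hC.le, Real.sq_sqrt hL.le, Real.sq_sqrt he.le]
    field_simp
  have h1 : y ^ 2 < dminDef γ₂ ω₁ C L e ^ 2 := pow_lt_pow_left₀ hy hy0 two_ne_zero
  have hinv : ω₁⁻¹ ≤ 1 := inv_le_one_of_one_le₀ hω₁.le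
  have hle : (γ₂ * ω₁⁻¹) ^ 2 ≤ 1 :=
    pow_le_one₀ (by positivity) (mul_le_one₀ hγ₂1 (by positivity) hinv)
  calc C * L * y ^ 2 < C * L * dminDef γ₂ ω₁ C L e ^ 2 := mul_lt_mul_of_pos_left h1 hCL
    _ = (γ₂ * ω₁⁻¹) ^ 2 * e := by rw [mul_comm, hD]
    _ ≤ e := mul_le_of_le_one_left he.le hle

lemma one_le_piIdx {ε : ℕ → ℝ} (i : ℕ) : 1 ≤ piIdx ε i := by
  match i with
  | 0 => exact le_rfl
  | 1 => exact le_rfl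
  | i + 2 =>
    simp only [piIdx, nextPi]
    split_ifs
    · exact le_top
    · refine le_sInf ?_
      rintro _ ⟨m, hm, rfl⟩
      exact Nat.one_le_cast.2 hm.1

lemma half_le_of_lt_piIdx_succ {ε : ℕ → ℝ} {i P k : ℕ} (hi : 1 ≤ i) (hP : piIdx ε i = P)
    (hk1 : 1 ≤ k) (hk : (k : ℕ∞) < piIdx ε (i + 1)) : ε P / 2 ≤ ε k := by
  obtain ⟨j, rfl⟩ := Nat.exists_eq_add_of_le' hi
  by_contra! hlt
  simp only [piIdx, nextPi, hP, ENat.natCast_ne_top, if_false, ENat.toNat_natCast] at hk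
  exact not_le.2 hk (sInf_le (Set.mem_image_of_mem _ ⟨hk1, hlt⟩))

lemma piIdx_succ_spec {ε : ℕ → ℝ} {i Q : ℕ} (hi : 1 ≤ i) (hQ : piIdx ε (i + 1) = Q) :
    ∃ P : ℕ, piIdx ε i = P ∧ ε Q < ε P / 2 := by
  obtain ⟨j, rfl⟩ := Nat.exists_eq_add_of_le' hi
  have hne : piIdx ε (j + 1) ≠ ⊤ := by
    intro h
    simp [piIdx, nextPi, h] at hQ
  obtain ⟨P, hP⟩ := ENat.ne_top_iff_exists.1 hne
  refine ⟨P, hP.symm, ?_⟩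
  simp only [piIdx, nextPi, ← hP, ENat.natCast_ne_top, if_false, ENat.toNat_natCast] at hQ
  have hmem := csInf_mem (s := (fun m : ℕ => (m : ℕ∞)) '' {m : ℕ | 1 ≤ m ∧ ε m < ε P / 2}) (by
    rw [Set.nonempty_iff_ne_empty]
    intro h
    rw [h, sInf_empty] at hQ
    exact ENat.natCast_ne_top Q hQ.symm)
  rw [hQ] at hmem
  obtain ⟨m, hm, hmQ⟩ := hmem
  obtain rfl : m = Q := Nat.cast_injective hmQ
  exact hm.2

namespace CATTraj

variable {n : ℕ} {θ β ω₁ ω₂ γ₁ γ₂ γ₃ ξ L Δf : ℝ} {f : EuclideanSpace ℝ (Fin n) → ℝ}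
  {x d : ℕ → EuclideanSpace ℝ (Fin n)} {r δ ε : ℕ → ℝ} {b : ℕ → EReal}

lemma eps_succ_le (traj : CATTraj θ β ω₁ ω₂ γ₁ γ₂ γ₃ ξ f x d r δ ε b) {k : ℕ} (hk : 1 ≤ k) :
    ε (k + 1) ≤ ε k := by
  by_cases h : (f (x k + d k) : EReal) ≤ (f (x k) : EReal) + b k
  · rw [traj.eps_succ_dec k hk h]
    exact min_le_left _ _
  · rw [traj.eps_succ_keep k hk h]

lemma eps_anti (traj : CATTraj θ β ω₁ ω₂ γ₁ γ₂ γ₃ ξ f x d r δ ε b) {j k : ℕ} (hj : 1 ≤ j)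
    (hjk : j ≤ k) : ε k ≤ ε j := by
  induction k, hjk using Nat.le_induction with
  | base => exact le_rfl
  | succ k hk ih => exact (traj.eps_succ_le (hj.trans hk)).trans ih

lemma div_le_radius_succ (traj : CATTraj θ β ω₁ ω₂ γ₁ γ₂ γ₃ ξ f x d r δ ε b) (hω₁ : 1 < ω₁)
    {k : ℕ} (hk : 1 ≤ k) : r k / ω₁ ≤ r (k + 1) := by
  by_cases h : β ≤ rhoHat θ f (x k) (d k)
  · rw [traj.radius_succ k hk h]
    exact (div_le_self (traj.r_pos k hk).le hω₁.le).trans (le_max_right _ _)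
  · rw [traj.radius_fail k hk h]

lemma gradient_le (traj : CATTraj θ β ω₁ ω₂ γ₁ γ₂ γ₃ ξ f x d r δ ε b)
    (hA : Assumption1 L Δf f x d) {k : ℕ} (hk : 1 ≤ k) :
    ‖gradient f (x k + d k)‖ ≤ γ₁ * ε k + δ k * ‖d k‖ + L / 2 * ‖d k‖ ^ 2 := by
  have h1 := (hA k hk).2.1
  have h2 := traj.sub_grad k hk
  have h3 : ‖gradModel f (x k) (d k)‖ ≤
      ‖gradModel f (x k) (d k) + δ k • d k‖ + ‖δ k • d k‖ := norm_le_add_norm_add _ _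
  rw [norm_smul, Real.norm_of_nonneg (traj.δ_nonneg k hk)] at h3
  linarith

lemma multiplier_le_of_rhoHat_lt (traj : CATTraj θ β ω₁ ω₂ γ₁ γ₂ γ₃ ξ f x d r δ ε b)
    (hA : Assumption1 L Δf f x d) (hθ : 0 < θ) (hβ : 0 < β) (hβ1 : β < 1) (hγ₃ : 0 < γ₃)
    (hL : 0 < L) {k : ℕ} (hk : 1 ≤ k) (hρ : ¬ β ≤ rhoHat θ f (x k) (d k)) :
    γ₃ * (1 - β) * (δ k * ‖d k‖) ≤
      β * θ * ‖gradient f (x k + d k)‖ + L / 3 * ‖d k‖ ^ 2 := by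
  set g := ‖gradient f (x k + d k)‖
  set M := modelVal f (x k) (d k)
  have hg0 : 0 ≤ g := norm_nonneg _
  have hδ := traj.δ_nonneg k hk
  have hM1 : M ≤ -(γ₃ * (δ k / 2) * ‖d k‖ ^ 2) := traj.sub_decr k hk
  have hf := (hA k hk).2.2
  have hrhs : 0 ≤ β * θ * g + L / 3 * ‖d k‖ ^ 2 := by positivity
  rcases (norm_nonneg (d k)).eq_or_lt with h0 | hd
  · rw [← h0] at hrhs ⊢
    simpa using hrhs
  have hm0 : 0 ≤ min ‖gradient f (x k)‖ g := le_min (norm_nonneg _) hg0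
  have hmg : min ‖gradient f (x k)‖ g ≤ g := min_le_right _ _
  have hq0 : 0 ≤ γ₃ * (δ k / 2) * ‖d k‖ ^ 2 := by positivity
  have hp0 : 0 ≤ (θ / 2) * min ‖gradient f (x k)‖ g * ‖d k‖ := by positivity
  have hden : 0 ≤ -M + (θ / 2) * min ‖gradient f (x k)‖ g * ‖d k‖ := by linarith
  have hβ' : 0 < 1 - β := by linarith
  have hmain : (1 - β) * (-M) ≤ β * ((θ / 2) * g * ‖d k‖) + L / 6 * ‖d k‖ ^ 3 := by
    have hp : (θ / 2) * min ‖gradient f (x k)‖ g * ‖d k‖ ≤ (θ / 2) * g * ‖d k‖ := by gcongr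
    have hβp := mul_le_mul_of_nonneg_left hp hβ.le
    rcases hden.eq_or_lt with h0 | hpos
    · have hM0 : M = 0 := by linarith
      have : 0 ≤ β * ((θ / 2) * g * ‖d k‖) + L / 6 * ‖d k‖ ^ 3 := by positivity
      simpa [hM0] using this
    · have hlt := not_le.1 hρ
      rw [rhoHat, div_lt_iff₀ hpos] at hlt
      linarith
  have h1 := mul_le_mul_of_nonneg_left hM1 hβ'.le
  refine le_of_mul_le_mul_right ?_ hd
  linarith

/-- A step shorter than `d_min` whose multiplier is small relative to the new gradient brings
`ε` below half of its reference value. -/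
lemma eps_succ_lt_half (traj : CATTraj θ β ω₁ ω₂ γ₁ γ₂ γ₃ ξ f x d r δ ε b)
    (hA : Assumption1 L Δf f x d) (hβ1 : β < 1) (hω₁ : 1 < ω₁) (hγ₃ : 0 < γ₃) (hγ₂ : 0 < γ₂)
    (hγ₂1 : γ₂ ≤ 1) (hγ₁0 : 0 ≤ γ₁) (hγ₁ : γ₁ < (1/2) * (1 - β * θ / (γ₃ * (1 - β))))
    (hξ : 0 < ξ) (hL : 0 < L) {k : ℕ} (hk : 1 ≤ k) {e : ℝ} (he : ε k ≤ e) (he2 : e / 2 ≤ ε k)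
    (hd : ‖d k‖ < dminDef γ₂ ω₁ (CDef θ β γ₃ γ₁ ξ) L e)
    (ht : γ₃ * (1 - β) * (δ k * ‖d k‖) ≤
      β * θ * ‖gradient f (x k + d k)‖ + L / 3 * ‖d k‖ ^ 2) : ε (k + 1) < e / 2 := by
  have hε := traj.ε_pos k hk
  have hC : 0 < CDef θ β γ₃ γ₁ ξ := CDef_pos hξ
  have hsmall := mul_sq_lt_of_lt_dminDef hγ₂ hγ₂1 hω₁ hC hL (hε.trans_le he) (norm_nonneg _) hd
  have hg := gradient_lt_half hγ₁0 (mul_pos hγ₃ (by linarith)) (parameter_gap_pos hβ1 hγ₃ hγ₁)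
    (CDef_mul_gap (ξ := ξ) hβ1 hγ₃ hγ₁0 hγ₁) hL (sq_nonneg ‖d k‖) (traj.gradient_le hA hk) ht
    he hsmall
  have hCξ : 1 ≤ 3 * ξ * CDef θ β γ₃ γ₁ ξ := by
    have := le_max_left (1 / (3 * ξ)) (2 * c1Def θ β γ₃ / (1 - 2 * γ₁ * c2Def θ β γ₃))
    rwa [← CDef, div_le_iff₀' (by positivity)] at this
  have hLd : L * ‖d k‖ ^ 2 ≤ 6 * ξ * ε k := by
    have h1 := mul_le_mul_of_nonneg_right hCξ (by positivity : 0 ≤ L * ‖d k‖ ^ 2)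
    have h2 := mul_le_mul_of_nonneg_left (hsmall.le.trans (by linarith : e ≤ 2 * ε k))
      (by positivity : 0 ≤ 3 * ξ)
    linarith
  have hfle : f (x k + d k) ≤ f (x k) + ξ * ε k * ‖d k‖ := by
    have h1 := (hA k hk).2.2
    have h2 := traj.sub_decr k hk
    have hδ := traj.δ_nonneg k hk
    have h3 : 0 ≤ γ₃ * (δ k / 2) * ‖d k‖ ^ 2 := by positivity
    have h4 := mul_le_mul_of_nonneg_right hLd (norm_nonneg (d k))
    linarith
  have hacc : (f (x k + d k) : EReal) ≤ (f (x k) : EReal) + b k := by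
    refine le_trans (b := (f (x k) : EReal) + ((ξ * ε k * ‖d k‖ : ℝ) : EReal)) ?_ ?_
    · exact_mod_cast hfle
    · exact add_le_add le_rfl (traj.b_lb k hk)
  rw [traj.eps_succ_dec k hk hacc]
  exact (min_le_right _ _).trans_lt hg

/-- A short step that does not end the phase is successful and nearly fills the trust region. -/
lemma short_step (traj : CATTraj θ β ω₁ ω₂ γ₁ γ₂ γ₃ ξ f x d r δ ε b)
    (hA : Assumption1 L Δf f x d) (hθ : 0 < θ) (hβ : 0 < β) (hβ1 : β < 1) (hω₁ : 1 < ω₁)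
    (hγ₃ : 0 < γ₃) (hγ₂ : 0 < γ₂) (hγ₂1 : γ₂ ≤ 1) (hγ₁0 : 0 ≤ γ₁)
    (hγ₁ : γ₁ < (1/2) * (1 - β * θ / (γ₃ * (1 - β)))) (hξ : 0 < ξ) (hL : 0 < L) {k : ℕ}
    (hk : 1 ≤ k) {e : ℝ} (he : ε k ≤ e) (he2 : e / 2 ≤ ε (k + 1))
    (hd : ‖d k‖ < dminDef γ₂ ω₁ (CDef θ β γ₃ γ₁ ξ) L e) :
    β ≤ rhoHat θ f (x k) (d k) ∧ γ₂ * r k ≤ ‖d k‖ := by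
  have hkey := traj.eps_succ_lt_half hA hβ1 hω₁ hγ₃ hγ₂ hγ₂1 hγ₁0 hγ₁ hξ hL hk he
    (he2.trans (traj.eps_succ_le hk)) hd
  constructor
  · by_contra hρ
    exact absurd (hkey (traj.multiplier_le_of_rhoHat_lt hA hθ hβ hβ1 hγ₃ hL hk hρ))
      (not_lt.2 he2)
  · rcases (traj.δ_nonneg k hk).eq_or_lt with h0 | hpos
    · refine absurd (hkey ?_) (not_lt.2 he2)
      rw [← h0]
      simp only [zero_mul, mul_zero]
      positivity
    · refine le_of_mul_le_mul_left ?_ hpos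
      linarith [traj.sub_comp k hk]

lemma min_le_radius_of_phase (traj : CATTraj θ β ω₁ ω₂ γ₁ γ₂ γ₃ ξ f x d r δ ε b)
    (hA : Assumption1 L Δf f x d) (hθ : 0 < θ) (hβ : 0 < β) (hβ1 : β < 1) (hω₁ : 1 < ω₁)
    (hγ₃ : 0 < γ₃) (hγ₂ : 0 < γ₂) (hγ₂1 : γ₂ ≤ 1) (hγ₁0 : 0 ≤ γ₁)
    (hγ₁ : γ₁ < (1/2) * (1 - β * θ / (γ₃ * (1 - β)))) (hξ : 0 < ξ) (hL : 0 < L) {P k : ℕ}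
    (hP : 1 ≤ P) (hPk : P ≤ k) (hk : ε P / 2 ≤ ε k) :
    min (r P) (dminDef γ₂ ω₁ (CDef θ β γ₃ γ₁ ξ) L (ε P) / ω₁) ≤ r k := by
  induction k, hPk using Nat.le_induction with
  | base => exact min_le_left _ _
  | succ k hPk ih =>
    have hk1 := hP.trans hPk
    have ih := ih (hk.trans (traj.eps_succ_le hk1))
    by_cases hρ : β ≤ rhoHat θ f (x k) (d k)
    · rw [traj.radius_succ k hk1 hρ]
      exact ih.trans (le_max_right _ _)
    · rw [traj.radius_fail k hk1 hρ]
      refine (min_le_right _ _).trans (div_le_div_of_nonneg_right ?_ (by linarith))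
      by_contra! hlt
      exact hρ (traj.short_step hA hθ hβ hβ1 hω₁ hγ₃ hγ₂ hγ₂1 hγ₁0 hγ₁ hξ hL hk1
        (traj.eps_anti hP hPk) hk ((traj.sub_rad k hk1).trans_lt hlt)).1

/-- Lower bound for the trust-region radius at the start of the `i`-th phase. -/
lemma min_div_pow_le_radius (traj : CATTraj θ β ω₁ ω₂ γ₁ γ₂ γ₃ ξ f x d r δ ε b)
    (hA : Assumption1 L Δf f x d) (hθ : 0 < θ) (hβ : 0 < β) (hβ1 : β < 1) (hω₁ : 1 < ω₁)
    (hγ₃ : 0 < γ₃) (hγ₂ : 0 < γ₂) (hγ₂1 : γ₂ ≤ 1) (hγ₁0 : 0 ≤ γ₁)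
    (hγ₁ : γ₁ < (1/2) * (1 - β * θ / (γ₃ * (1 - β)))) (hξ : 0 < ξ) (hL : 0 < L) {i : ℕ}
    (hi : 1 ≤ i) (Q : ℕ) (hQ : piIdx ε i = Q) :
    min (r 1) (dminDef γ₂ ω₁ (CDef θ β γ₃ γ₁ ξ) L (ε Q)) / ω₁ ^ i ≤ r Q := by
  have hω0 : 0 < ω₁ := by linarith
  have hC : 0 < CDef θ β γ₃ γ₁ ξ := CDef_pos hξ
  induction i, hi using Nat.le_induction generalizing Q with
  | base =>
    obtain rfl : Q = 1 := by
      have : ((1 : ℕ) : ℕ∞) = Q := by simpa [piIdx] using hQ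
      exact_mod_cast this.symm
    have hr := traj.r_pos 1 le_rfl
    have hD := dminDef_pos hγ₂ hω0 hC hL (traj.ε_pos 1 le_rfl)
    exact (div_le_self (le_min hr.le hD.le) (one_le_pow₀ hω₁.le)).trans (min_le_left _ _)
  | succ i hi ih =>
    obtain ⟨P, hP', hlt⟩ := piIdx_succ_spec hi hQ
    have hP1 : 1 ≤ P := by
      have := one_le_piIdx (ε := ε) i
      rw [hP'] at this
      exact_mod_cast this
    have hQ1 : 1 ≤ Q := by
      have := one_le_piIdx (ε := ε) (i + 1)
      rw [hQ] at this
      exact_mod_cast this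
    have hεP := traj.ε_pos P hP1
    have hPQ : P < Q := by
      by_contra! h
      linarith [traj.eps_anti hQ1 h]
    obtain ⟨k, rfl⟩ : ∃ k, Q = k + 1 := ⟨Q - 1, by omega⟩
    have hPk : P ≤ k := by omega
    have hkhalf : ε P / 2 ≤ ε k := by
      refine half_le_of_lt_piIdx_succ hi hP' (hP1.trans hPk) ?_
      rw [hQ]
      exact_mod_cast Nat.lt_succ_self k
    have hrk := traj.min_le_radius_of_phase hA hθ hβ hβ1 hω₁ hγ₃ hγ₂ hγ₂1 hγ₁0 hγ₁ hξ hL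
      hP1 hPk hkhalf
    have hr := traj.r_pos 1 le_rfl
    have hD := dminDef_pos hγ₂ hω0 hC hL hεP
    have hmono : dminDef γ₂ ω₁ (CDef θ β γ₃ γ₁ ξ) L (ε (k + 1)) ≤
        dminDef γ₂ ω₁ (CDef θ β γ₃ γ₁ ξ) L (ε P) :=
      dminDef_mono hγ₂ hω0 (traj.eps_anti hP1 hPQ.le)
    set D := dminDef γ₂ ω₁ (CDef θ β γ₃ γ₁ ξ) L (ε P)
    have hm0 : 0 ≤ min (r 1) D := le_min hr.le hD.le
    have hlow : min (r 1) D / ω₁ ^ i ≤ r k := by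
      refine le_trans (le_min (ih P hP') ?_) hrk
      calc min (r 1) D / ω₁ ^ i ≤ min (r 1) D / ω₁ :=
            div_le_div_of_nonneg_left hm0 hω0 (le_self_pow₀ hω₁.le (by omega))
        _ ≤ D / ω₁ := div_le_div_of_nonneg_right (min_le_right _ _) hω0.le
    calc min (r 1) (dminDef γ₂ ω₁ (CDef θ β γ₃ γ₁ ξ) L (ε (k + 1))) / ω₁ ^ (i + 1)
        ≤ min (r 1) D / ω₁ ^ (i + 1) :=
          div_le_div_of_nonneg_right (min_le_min_left _ hmono) (by positivity)
      _ = min (r 1) D / ω₁ ^ i / ω₁ := by rw [pow_succ, div_div]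
      _ ≤ r k / ω₁ := div_le_div_of_nonneg_right hlow hω0.le
      _ ≤ r (k + 1) := traj.div_le_radius_succ hω₁ (hP1.trans hPk)

/-- A run of `N + 2` short steps inside one phase forces geometric growth of the radius. -/
lemma pow_mul_radius_le_of_short_run (traj : CATTraj θ β ω₁ ω₂ γ₁ γ₂ γ₃ ξ f x d r δ ε b)
    (hA : Assumption1 L Δf f x d) (hθ : 0 < θ) (hβ : 0 < β) (hβ1 : β < 1) (hω₁ : 1 < ω₁)
    (hω₂ : 0 < ω₂)
    (hγ₃ : 0 < γ₃) (hγ₂ : 0 < γ₂) (hγ₂1 : γ₂ ≤ 1) (hγ₁0 : 0 ≤ γ₁)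
    (hγ₁ : γ₁ < (1/2) * (1 - β * θ / (γ₃ * (1 - β)))) (hξ : 0 < ξ) (hL : 0 < L) {P N : ℕ}
    (hP : 1 ≤ P)
    (hrun : ∀ k, P ≤ k → k < P + (N + 2) → ε P / 2 ≤ ε k ∧
      ‖d k‖ < dminDef γ₂ ω₁ (CDef θ β γ₃ γ₁ ξ) L (ε P)) :
    γ₂ * ((γ₂ * ω₂) ^ N * r P) ≤ dminDef γ₂ ω₁ (CDef θ β γ₃ γ₁ ξ) L (ε P) := by
  have hstep : ∀ m ≤ N, β ≤ rhoHat θ f (x (P + m)) (d (P + m)) ∧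
      γ₂ * r (P + m) ≤ ‖d (P + m)‖ := fun m hm =>
    traj.short_step hA hθ hβ hβ1 hω₁ hγ₃ hγ₂ hγ₂1 hγ₁0 hγ₁ hξ hL (by omega)
      (traj.eps_anti hP (by omega)) (hrun (P + m + 1) (by omega) (by omega)).1
      (hrun (P + m) (by omega) (by omega)).2
  have hgrow : ∀ m ≤ N, (γ₂ * ω₂) ^ m * r P ≤ r (P + m) := by
    intro m
    induction m with
    | zero => simp
    | succ m ih =>
      intro hm
      obtain ⟨hρ, hfill⟩ := hstep m (by omega)
      have hr : r (P + (m + 1)) = max (ω₂ * ‖d (P + m)‖) (r (P + m)) :=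
        traj.radius_succ (P + m) (by omega) hρ
      calc (γ₂ * ω₂) ^ (m + 1) * r P = ω₂ * (γ₂ * ((γ₂ * ω₂) ^ m * r P)) := by ring
        _ ≤ ω₂ * (γ₂ * r (P + m)) := by gcongr; exact ih (by omega)
        _ ≤ ω₂ * ‖d (P + m)‖ := by gcongr
        _ ≤ r (P + (m + 1)) := hr ▸ le_max_left _ _
  calc γ₂ * ((γ₂ * ω₂) ^ N * r P) ≤ γ₂ * r (P + N) := by gcongr; exact hgrow N le_rfl
    _ ≤ ‖d (P + N)‖ := (hstep N le_rfl).2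
    _ ≤ _ := (hrun (P + N) (by omega) (by omega)).2.le

/-- Length bound, in exponential form, for a run of short steps starting at `π(i)`. -/
lemma pow_le_of_short_run (traj : CATTraj θ β ω₁ ω₂ γ₁ γ₂ γ₃ ξ f x d r δ ε b)
    (hA : Assumption1 L Δf f x d) (hθ : 0 < θ) (hβ : 0 < β) (hβ1 : β < 1) (hω₁ : 1 < ω₁)
    (hω₂ : ω₁ ≤ ω₂)
    (hγ₃ : 0 < γ₃) (hγ₂ : 0 < γ₂) (hγ₂1 : γ₂ ≤ 1) (hγ₁0 : 0 ≤ γ₁)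
    (hγ₁ : γ₁ < (1/2) * (1 - β * θ / (γ₃ * (1 - β)))) (hξ : 0 < ξ) (hL : 0 < L) {i P N : ℕ}
    (hi : 1 ≤ i) (hPi : piIdx ε i = P)
    (hrun : ∀ k, P ≤ k → k < P + N → ε P / 2 ≤ ε k ∧
      ‖d k‖ < dminDef γ₂ ω₁ (CDef θ β γ₃ γ₁ ξ) L (ε P)) :
    (γ₂ * ω₂) ^ N ≤
      ω₂ ^ (3 * i) * max (dminDef γ₂ ω₁ (CDef θ β γ₃ γ₁ ξ) L (ε P) / r 1) 1 := by
  have hω0 : 0 < ω₁ := by linarith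
  have hω2 : 1 ≤ ω₂ := hω₁.le.trans hω₂
  have hω20 : 0 < ω₂ := by linarith
  have hP1 : 1 ≤ P := by
    have := one_le_piIdx (ε := ε) i
    rw [hPi] at this
    exact_mod_cast this
  rcases lt_or_ge N 2 with hN | hN
  · calc (γ₂ * ω₂) ^ N ≤ ω₂ ^ N := by
          gcongr; exact mul_le_of_le_one_left hω20.le hγ₂1
      _ ≤ ω₂ ^ (3 * i) := pow_le_pow_right₀ hω2 (by omega)
      _ ≤ _ := le_mul_of_one_le_right (by positivity) (le_max_right _ _)
  obtain ⟨M, rfl⟩ := Nat.exists_eq_add_of_le' hN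
  have hbound := traj.pow_mul_radius_le_of_short_run hA hθ hβ hβ1 hω₁ hω20 hγ₃ hγ₂ hγ₂1 hγ₁0
    hγ₁ hξ hL hP1 hrun
  have hlow := traj.min_div_pow_le_radius hA hθ hβ hβ1 hω₁ hγ₃ hγ₂ hγ₂1 hγ₁0 hγ₁ hξ hL hi P hPi
  have hr := traj.r_pos 1 le_rfl
  have hD := dminDef_pos (γ₂ := γ₂) hγ₂ hω0 (CDef_pos (θ := θ) (β := β) (γ₃ := γ₃) (γ₁ := γ₁) hξ)
    hL (traj.ε_pos P hP1)
  set D := dminDef γ₂ ω₁ (CDef θ β γ₃ γ₁ ξ) L (ε P)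
  have hm : 0 < min (r 1) D := lt_min hr hD
  have hmax : D = min (r 1) D * max (D / r 1) 1 := by
    rcases le_total (r 1) D with h | h
    · rw [min_eq_left h, max_eq_left ((one_le_div hr).2 h), mul_div_cancel₀ _ hr.ne']
    · rw [min_eq_right h, max_eq_right ((div_le_one hr).2 h), mul_one]
  have hmax0 : 0 ≤ max (D / r 1) 1 := le_trans zero_le_one (le_max_right _ _)
  have h1 : γ₂ * (γ₂ * ω₂) ^ M ≤ ω₁ ^ i * max (D / r 1) 1 := by
    refine le_of_mul_le_mul_right ?_ hm
    calc γ₂ * (γ₂ * ω₂) ^ M * min (r 1) D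
        = ω₁ ^ i * (γ₂ * ((γ₂ * ω₂) ^ M * (min (r 1) D / ω₁ ^ i))) := by field_simp
      _ ≤ ω₁ ^ i * (γ₂ * ((γ₂ * ω₂) ^ M * r P)) := by gcongr
      _ ≤ ω₁ ^ i * D := by gcongr
      _ = ω₁ ^ i * max (D / r 1) 1 * min (r 1) D := by rw [mul_assoc, mul_comm (max _ _), ← hmax]
  calc (γ₂ * ω₂) ^ (M + 2) = γ₂ * (ω₂ ^ 2 * (γ₂ * (γ₂ * ω₂) ^ M)) := by ring
    _ ≤ 1 * (ω₂ ^ 2 * (γ₂ * (γ₂ * ω₂) ^ M)) := by gcongr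
    _ ≤ 1 * (ω₂ ^ 2 * (ω₂ ^ i * max (D / r 1) 1)) := by
        refine mul_le_mul_of_nonneg_left (mul_le_mul_of_nonneg_left (h1.trans ?_) ?_) zero_le_one
        · gcongr
        · positivity
    _ = ω₂ ^ (2 + i) * max (D / r 1) 1 := by ring
    _ ≤ _ := by
        gcongr
        omega

end CATTraj

/-- Every index between `π(i)` and `τ(i)` is a short step inside the `i`-th phase. -/
lemma short_of_lt_tauIdx {n : ℕ} {γ₂ ω₁ C L : ℝ} {d : ℕ → EuclideanSpace ℝ (Fin n)} {ε : ℕ → ℝ}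
    {i P k : ℕ} (hi : 1 ≤ i) (hP : piIdx ε i = P) (hP1 : 1 ≤ P) (hPk : P ≤ k)
    (hk : (k : ℕ∞) < tauIdx γ₂ ω₁ C L d ε i) :
    ε P / 2 ≤ ε k ∧ ‖d k‖ < dminDef γ₂ ω₁ C L (ε P) := by
  simp only [tauIdx, hP, ENat.natCast_ne_top, if_false, ENat.toNat_natCast, lt_min_iff] at hk
  refine ⟨half_le_of_lt_piIdx_succ hi hP (hP1.trans hPk) hk.2, ?_⟩
  by_contra! h
  exact not_le.2 hk.1 (sInf_le (Set.mem_image_of_mem _ ⟨hPk, h⟩))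

/-- Lemma 3: bound on the length of phase one, `τ(i) − π(i)`. -/
theorem phase_one_bound {n : ℕ} (hn : 1 ≤ n) (θ β ω₁ ω₂ γ₁ γ₂ γ₃ ξ L Δf : ℝ)
    (hθ : 0 < θ ∧ θ < 1) (hβ : 0 < β ∧ β < 1)
    (hω₁ : 1 < ω₁) (hω₂ : ω₁ ≤ ω₂)
    (hγ₃ : 0 < γ₃ ∧ γ₃ ≤ 1) (hγ₂ : ω₁⁻¹ < γ₂ ∧ γ₂ ≤ 1)
    (hγ₁ : 0 ≤ γ₁ ∧ γ₁ < (1/2) * (1 - β * θ / (γ₃ * (1 - β))))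
    (hξ : 0 < ξ)
    (f : EuclideanSpace ℝ (Fin n) → ℝ)
    (x d : ℕ → EuclideanSpace ℝ (Fin n)) (r δ ε : ℕ → ℝ) (b : ℕ → EReal)
    (traj : CATTraj θ β ω₁ ω₂ γ₁ γ₂ γ₃ ξ f x d r δ ε b)
    (hL : 0 < L) (hΔf : 0 < Δf) (hA : Assumption1 L Δf f x d) :
    ∀ i : ℕ, 1 ≤ i → piIdx ε i ≠ ⊤ →
      tauIdx γ₂ ω₁ (CDef θ β γ₃ γ₁ ξ) L d ε i ≠ ⊤ ∧
      ((tauIdx γ₂ ω₁ (CDef θ β γ₃ γ₁ ξ) L d ε i).toNat : ℝ) - ((piIdx ε i).toNat : ℝ) ≤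
        Real.logb (γ₂ * ω₂)
          (ω₂ ^ (3 * i) *
            max (dminDef γ₂ ω₁ (CDef θ β γ₃ γ₁ ξ) L (ε (piIdx ε i).toNat) / r 1) 1) := by
  intro i hi hfin
  obtain ⟨P, hP⟩ := ENat.ne_top_iff_exists.1 hfin
  have hγ₂0 : 0 < γ₂ := lt_trans (by positivity) hγ₂.1
  have hω20 : 0 < ω₂ := by linarith
  have hbase : 1 < γ₂ * ω₂ := by
    calc 1 = ω₁⁻¹ * ω₁ := (inv_mul_cancel₀ (by linarith)).symm
      _ < γ₂ * ω₁ := mul_lt_mul_of_pos_right hγ₂.1 (by linarith)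
      _ ≤ γ₂ * ω₂ := mul_le_mul_of_nonneg_left hω₂ hγ₂0.le
  have hP1 : 1 ≤ P := by
    have := one_le_piIdx (ε := ε) i
    rw [← hP] at this
    exact_mod_cast this
  simp only [← hP, ENat.toNat_natCast]
  set τ := tauIdx γ₂ ω₁ (CDef θ β γ₃ γ₁ ξ) L d ε i
  set B := ω₂ ^ (3 * i) * max (dminDef γ₂ ω₁ (CDef θ β γ₃ γ₁ ξ) L (ε P) / r 1) 1
  have hrun : ∀ N : ℕ, ((P + N : ℕ) : ℕ∞) ≤ τ → (N : ℝ) ≤ Real.logb (γ₂ * ω₂) B := by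
    intro N hN
    have hpow : (γ₂ * ω₂) ^ N ≤ B :=
      traj.pow_le_of_short_run hA hθ.1 hβ.1 hβ.2 hω₁ hω₂ hγ₃.1 hγ₂0 hγ₂.2 hγ₁.1 hγ₁.2 hξ hL hi
        hP.symm fun k hPk hk => short_of_lt_tauIdx hi hP.symm hP1 hPk
          (lt_of_lt_of_le (by exact_mod_cast hk) hN)
    have hBpos : 0 < B := lt_of_lt_of_le (by positivity) hpow
    rw [Real.le_logb_iff_rpow_le hbase hBpos, Real.rpow_natCast]
    exact hpow
  have hτfin : τ ≠ ⊤ := by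
    intro htop
    obtain ⟨N, hN⟩ := exists_nat_gt (Real.logb (γ₂ * ω₂) B)
    exact absurd (hrun N (htop ▸ le_top)) (not_le.2 hN)
  refine ⟨hτfin, ?_⟩
  obtain ⟨T, hT⟩ := ENat.ne_top_iff_exists.1 hτfin
  rw [← hT, ENat.toNat_natCast]
  rcases le_total P T with hPT | hTP
  · have h := hrun (T - P) (by rw [← hT, Nat.add_sub_cancel' hPT])
    rwa [Nat.cast_sub hPT] at h
  · have hTP' : (T : ℝ) ≤ P := by exact_mod_cast hTP
    have hB1 : 1 ≤ B :=
      one_le_mul_of_one_le_of_one_le (one_le_pow₀ (hω₁.le.trans hω₂)) (le_max_right _ _)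
    linarith [Real.logb_nonneg hbase hB1]
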